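/- Let s ≥ 0, T ≥ 0, let B ⊆ [0,T] × ℝ be Borel, and let G : ℝ → ℝ be any function. For q ∈ ℝ let Γ(q) denote the set of s-Lipschitz functions γ : [0,T] → ℝ with γ(T) = q, define the cost C(γ) = G(γ(0)) + λ({t ∈ [0,T] : (t, γ(t)) ∈ B}), and let V(q) = inf_{γ ∈ Γ(q)} C(γ). Suppose q₁ ≤ q₂, and γ₁ ∈ Γ(q₁), γ₂ ∈ Γ(q₂) are minimizers, i.e. C(γ₁) = V(q₁) and C(γ₂) = V(q₂), but with γ₁(0) > γ₂(0). Then there exist minimizers σ₁ ∈ Γ(q₁) with σ₁(0) = γ₂(0) and C(σ₁) = V(q₁), and σ₂ ∈ Γ(q₂) with σ₂(0) = γ₁(0) and C(σ₂) = V(q₂). (Exchange property of optimal starting points: this is the honest core of the paper's Lemma that the function Ψ(λ_i) — the highest optimal starting point on Λ_{i−1} for an optimal traversal ending at λ_i ∈ Λ_i — is monotone in λ_i.) -/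

import Mathlib

open MeasureTheory Set
open scoped ENNReal

/-- `γ` is an `s`-Lipschitz traversal on the time interval `[0, T]`. -/
def IsSLip (s T : ℝ) (γ : ℝ → ℝ) : Prop :=
  ∀ t ∈ Set.Icc (0:ℝ) T, ∀ t' ∈ Set.Icc (0:ℝ) T, |γ t - γ t'| ≤ s * |t - t'|

/-- Cost of a traversal `γ` ending at time `T`: the accumulated cost `G (γ 0)` at its
starting point plus the time its graph spends in the obstacle set `B`. -/
noncomputable def dpCost (T : ℝ) (B : Set (ℝ × ℝ)) (G : ℝ → ℝ) (γ : ℝ → ℝ) : EReal :=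
  (G (γ 0) : EReal) + (volume {t ∈ Set.Icc (0:ℝ) T | (t, γ t) ∈ B} : ℝ≥0∞)

/-- The function following `a` up to time `τ` and `b` afterwards. -/
noncomputable def splice (τ : ℝ) (a b : ℝ → ℝ) (t : ℝ) : ℝ :=
  if t ≤ τ then a t else b t

theorem IsSLip.continuousOn {s T : ℝ} {γ : ℝ → ℝ} (hs : 0 ≤ s) (h : IsSLip s T γ) :
    ContinuousOn γ (Icc 0 T) := by
  have hL : LipschitzOnWith ⟨s, hs⟩ γ (Icc 0 T) :=
    LipschitzOnWith.of_dist_le_mul fun t ht t' ht' =>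
      h t ht t' ht'
  exact hL.continuousOn

theorem IsSLip.splice {s T τ : ℝ} {a b : ℝ → ℝ} (ha : IsSLip s T a) (hb : IsSLip s T b)
    (hτ : τ ∈ Icc 0 T) (hab : a τ = b τ) : IsSLip s T (splice τ a b) := by
  have cross : ∀ t ∈ Icc (0:ℝ) T, ∀ t' ∈ Icc (0:ℝ) T, t ≤ τ → τ < t' →
      |a t - b t'| ≤ s * |t - t'| := by
    intro t ht t' ht' h h'
    have h₁ := ha t ht τ hτ
    have h₂ := hb τ hτ t' ht'
    have h₃ := abs_sub_le (a t) (a τ) (b t')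
    rw [abs_of_nonpos (sub_nonpos.mpr h)] at h₁
    rw [← hab, abs_of_neg (sub_neg.mpr h')] at h₂
    rw [abs_of_neg (sub_neg.mpr (h.trans_lt h'))]
    linarith
  intro t ht t' ht'
  unfold _root_.splice
  split_ifs with h h' h'
  · exact ha t ht t' ht'
  · exact cross t ht t' ht' h (not_le.mp h')
  · rw [abs_sub_comm, abs_sub_comm t]
    exact cross t' ht' t ht h' (not_le.mp h)
  · exact hb t ht t' ht'

theorem splice_zero {τ : ℝ} {a b : ℝ → ℝ} (hτ : 0 ≤ τ) : splice τ a b 0 = a 0 :=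
  if_pos hτ

theorem splice_end {T τ : ℝ} {a b : ℝ → ℝ} (hτ : τ ≤ T) (hab : a τ = b τ) :
    splice τ a b T = b T := by
  unfold splice
  split_ifs with h
  · rw [le_antisymm h hτ, hab]
  · rfl

theorem dpCost_eq_add {T τ : ℝ} (hτ : τ ∈ Icc 0 T) (B : Set (ℝ × ℝ)) (G γ : ℝ → ℝ) :
    dpCost T B G γ = ((G (γ 0) + volume.real {t ∈ Icc 0 τ | (t, γ t) ∈ B} +
      volume.real {t ∈ Ioc τ T | (t, γ t) ∈ B} : ℝ) : EReal) := by
  have hfin : volume {t ∈ Icc (0:ℝ) T | (t, γ t) ∈ B} ≠ ∞ :=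
    measure_ne_top_of_subset (sep_subset _ _) measure_Icc_lt_top.ne
  have hpre : {t ∈ Icc (0:ℝ) T | (t, γ t) ∈ B} ∩ Iic τ = {t ∈ Icc 0 τ | (t, γ t) ∈ B} := by
    ext t
    simp only [mem_inter_iff, mem_Icc, mem_Iic]
    exact ⟨fun h => ⟨⟨h.1.1.1, h.2⟩, h.1.2⟩,
      fun h => ⟨⟨⟨h.1.1, h.1.2.trans hτ.2⟩, h.2⟩, h.1.2⟩⟩
  have hpost : {t ∈ Icc (0:ℝ) T | (t, γ t) ∈ B} \ Iic τ = {t ∈ Ioc τ T | (t, γ t) ∈ B} := by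
    ext t
    simp only [mem_sdiff, mem_Icc, mem_Iic, mem_Ioc, not_le]
    exact ⟨fun h => ⟨⟨h.2, h.1.1.2⟩, h.1.2⟩,
      fun h => ⟨⟨⟨hτ.1.trans h.1.1.le, h.1.2⟩, h.2⟩, h.1.1⟩⟩
  have hsplit := measureReal_inter_add_sdiff (μ := volume)
    (s := {t ∈ Icc (0:ℝ) T | (t, γ t) ∈ B}) (measurableSet_Iic (a := τ)) hfin
  rw [hpre, hpost] at hsplit
  rw [add_assoc, hsplit, EReal.coe_add, dpCost, Measure.real, EReal.coe_ennreal_toReal hfin]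

theorem dpCost_splice {T τ : ℝ} (hτ : τ ∈ Icc 0 T) (B : Set (ℝ × ℝ)) (G a b : ℝ → ℝ) :
    dpCost T B G (splice τ a b) = ((G (a 0) + volume.real {t ∈ Icc 0 τ | (t, a t) ∈ B} +
      volume.real {t ∈ Ioc τ T | (t, b t) ∈ B} : ℝ) : EReal) := by
  have hpre : {t ∈ Icc 0 τ | (t, splice τ a b t) ∈ B} = {t ∈ Icc 0 τ | (t, a t) ∈ B} :=
    sep_ext_iff.mpr fun t ht => by rw [splice, if_pos ht.2]
  have hpost : {t ∈ Ioc τ T | (t, splice τ a b t) ∈ B} = {t ∈ Ioc τ T | (t, b t) ∈ B} :=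
    sep_ext_iff.mpr fun t ht => by rw [splice, if_neg ht.1.not_ge]
  rw [dpCost_eq_add hτ, splice_zero hτ.1, hpre, hpost]

/-- Exchange property of optimal starting points (core of the monotonicity of `Ψ`):
if `q₁ ≤ q₂` and optimal traversals `γ₁` to `q₁` and `γ₂` to `q₂` have
`γ₁(0) > γ₂(0)`, then there are optimal traversals `σ₁` to `q₁` starting at `γ₂(0)`
and `σ₂` to `q₂` starting at `γ₁(0)`. -/
theorem exchange_optimal_starts
    (s T : ℝ) (hs : 0 ≤ s) (hT : 0 ≤ T)
    (B : Set (ℝ × ℝ)) (hB : MeasurableSet B)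
    (hBsub : B ⊆ Set.Icc (0:ℝ) T ×ˢ (Set.univ : Set ℝ))
    (G : ℝ → ℝ) (V : ℝ → EReal)
    (hV : ∀ q, V q = sInf {c : EReal | ∃ γ : ℝ → ℝ, IsSLip s T γ ∧ γ T = q ∧
      c = dpCost T B G γ})
    (q₁ q₂ : ℝ) (hq : q₁ ≤ q₂)
    (γ₁ γ₂ : ℝ → ℝ)
    (h₁ : IsSLip s T γ₁) (h₁T : γ₁ T = q₁) (h₁opt : dpCost T B G γ₁ = V q₁)
    (h₂ : IsSLip s T γ₂) (h₂T : γ₂ T = q₂) (h₂opt : dpCost T B G γ₂ = V q₂)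
    (hstart : γ₂ 0 < γ₁ 0) :
    (∃ σ₁ : ℝ → ℝ, IsSLip s T σ₁ ∧ σ₁ T = q₁ ∧ σ₁ 0 = γ₂ 0 ∧ dpCost T B G σ₁ = V q₁) ∧
    (∃ σ₂ : ℝ → ℝ, IsSLip s T σ₂ ∧ σ₂ T = q₂ ∧ σ₂ 0 = γ₁ 0 ∧ dpCost T B G σ₂ = V q₂) := by
  obtain ⟨τ, hτ, hcross⟩ : ∃ τ ∈ Icc 0 T, γ₁ τ = γ₂ τ := by
    have hc := (h₁.continuousOn hs).sub (h₂.continuousOn hs)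
    obtain ⟨τ, hτ, h⟩ := intermediate_value_Icc' hT hc
      (show (0:ℝ) ∈ Icc (γ₁ T - γ₂ T) (γ₁ 0 - γ₂ 0) from
        ⟨by rw [h₁T, h₂T]; linarith, by linarith⟩)
    exact ⟨τ, hτ, sub_eq_zero.mp h⟩
  have hV_le : ∀ {q γ}, IsSLip s T γ → γ T = q → V q ≤ dpCost T B G γ := fun hγ hγT => by
    rw [hV]
    exact sInf_le ⟨_, hγ, hγT, rfl⟩
  have hL₁ := h₂.splice h₁ hτ hcross.symm
  have hL₂ := h₁.splice h₂ hτ hcross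
  have hT₁ := (splice_end hτ.2 hcross.symm).trans h₁T
  have hT₂ := (splice_end hτ.2 hcross).trans h₂T
  have hle₁ := hV_le hL₁ hT₁
  have hle₂ := hV_le hL₂ hT₂
  rw [← h₁opt, dpCost_splice hτ, dpCost_eq_add hτ, EReal.coe_le_coe_iff] at hle₁
  rw [← h₂opt, dpCost_splice hτ, dpCost_eq_add hτ, EReal.coe_le_coe_iff] at hle₂
  refine ⟨⟨splice τ γ₂ γ₁, hL₁, hT₁, splice_zero hτ.1, ?_⟩,
    ⟨splice τ γ₁ γ₂, hL₂, hT₂, splice_zero hτ.1, ?_⟩⟩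
  · rw [← h₁opt, dpCost_splice hτ, dpCost_eq_add hτ, EReal.coe_eq_coe_iff]
    linarith
  · rw [← h₂opt, dpCost_splice hτ, dpCost_eq_add hτ, EReal.coe_eq_coe_iff]
    linarith
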